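/- There exist absolute constants c, c', C > 0 such that the following holds for all sufficiently large n. Let Q° ∈ [0,1]^{n×n} be symmetric with zero diagonal, let d° := d(Q°) ≥ C, let R ≥ 1 satisfy Q°_ij ≤ R·d°/n for all i,j and R·d° ≥ 5, and let η ∈ (0, 1/e) satisfy η·log(1/η)·R ≤ c. Then with probability at least 1 − n^{−c'} over a random graph A° drawn from G(n,Q°), the following holds: for every n-node graph A with dist(A, A°) ≤ η·n there exist an n-node graph A* and z* ∈ {0,1}^n such that (i) |d(A*) − d°| ≤ 0.1·d°, and (ii) (A*, z*) satisfies the feasibility constraints P1(A, 2η) and (A*·𝟙)_i ≤ 2·log(1/η)·R·d(A*) for all i. -/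

import Mathlib

open scoped BigOperators Classical

namespace EdgeDensity

/-- A graph on `n` nodes, identified with its Boolean adjacency function:
symmetric with no self-loops. -/
def IsGraph {n : ℕ} (A : Fin n → Fin n → Bool) : Prop :=
  (∀ i j, A i j = A j i) ∧ ∀ i, A i i = false

/-- The real adjacency matrix of a Boolean graph. -/
def adjMat {n : ℕ} (A : Fin n → Fin n → Bool) : Matrix (Fin n) (Fin n) ℝ :=
  Matrix.of fun i j => if A i j then 1 else 0

/-- `d(M) = (1/n) ∑_{i,j} M i j`, the average row sum. -/
noncomputable def dbar {n : ℕ} (M : Matrix (Fin n) (Fin n) ℝ) : ℝ :=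
  (∑ i, ∑ j, M i j) / n

/-- `(M 𝟙)_i = ∑_j M i j`, the `i`-th row sum (degree of node `i`). -/
def rowSum {n : ℕ} (M : Matrix (Fin n) (Fin n) ℝ) (i : Fin n) : ℝ := ∑ j, M i j

/-- The probability that the inhomogeneous random graph `G(n,Q)` equals the
given graph `A`: each edge `{i,j}` with `i < j` is present independently with
probability `Q i j`. -/
noncomputable def erWeight {n : ℕ} (Q : Matrix (Fin n) (Fin n) ℝ)
    (A : Fin n → Fin n → Bool) : ℝ :=
  ∏ i, ∏ j ∈ Finset.univ.filter (fun j => i < j),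
    (if A i j then Q i j else 1 - Q i j)

/-- Probability of the event `E` under the inhomogeneous random graph `G(n,Q)`. -/
noncomputable def erProb {n : ℕ} (Q : Matrix (Fin n) (Fin n) ℝ)
    (E : (Fin n → Fin n → Bool) → Prop) : ℝ :=
  ∑ A ∈ Finset.univ.filter (fun A => IsGraph A ∧ E A), erWeight Q A

/-- Node distance between two graphs: the minimum cardinality of a set `S` of
nodes such that the two adjacency matrices agree on all entries `(i,j)` with
`i ∉ S` and `j ∉ S`. -/
noncomputable def nodeDist {n : ℕ} (A B : Fin n → Fin n → Bool) : ℕ :=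
  sInf {k | ∃ S : Finset (Fin n), S.card = k ∧
    ∀ i j, i ∉ S → j ∉ S → A i j = B i j}

/-- The feasibility constraints `P1(A, γ)` on a pair `(Y, z)`. -/
def P1 {n : ℕ} (A : Matrix (Fin n) (Fin n) ℝ) (γ : ℝ)
    (Y : Matrix (Fin n) (Fin n) ℝ) (z : Fin n → ℝ) : Prop :=
  (∀ i, z i = 0 ∨ z i = 1) ∧
  ((1 - γ) * n ≤ ∑ i, z i) ∧
  (∀ i j, Y i j = Y j i) ∧
  (∀ i j, 0 ≤ Y i j ∧ Y i j ≤ 1) ∧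
  (∀ i j, Y i j * z i * z j = A i j * z i * z j)

/-- The binomial probability mass function `Bin(n,p)` at `k`. -/
noncomputable def binomPMF (n : ℕ) (p : ℝ) (k : ℕ) : ℝ :=
  (n.choose k : ℝ) * p ^ k * (1 - p) ^ (n - k)

/-- Total variation distance between `Bin(n,p)` and `Bin(n,q)`. -/
noncomputable def binomTV (n : ℕ) (p q : ℝ) : ℝ :=
  (∑ k ∈ Finset.range (n + 1), |binomPMF n p k - binomPMF n q k|) / 2

/-- The spectral norm (largest singular value) of a real square matrix. -/
noncomputable def specNorm {n : ℕ} (M : Matrix (Fin n) (Fin n) ℝ) : ℝ :=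
  ‖LinearMap.toContinuousLinearMap (Matrix.toEuclideanLin M)‖

/-- A randomized algorithm on `n`-node graphs is `ε`-differentially
node-private. -/
def IsNodeDP {n : ℕ} (ε : ℝ)
    (𝒜 : (Fin n → Fin n → Bool) → MeasureTheory.Measure ℝ) : Prop :=
  ∀ G G', IsGraph G → IsGraph G' → nodeDist G G' ≤ 1 →
    ∀ S : Set ℝ, MeasurableSet S →
      𝒜 G S ≤ ENNReal.ofReal (Real.exp ε) * 𝒜 G' S

/-- `Pr_{G ~ G(n,Q), 𝒜}[𝒜(G) ∈ S]`. -/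
noncomputable def algProb {n : ℕ} (Q : Matrix (Fin n) (Fin n) ℝ)
    (𝒜 : (Fin n → Fin n → Bool) → MeasureTheory.Measure ℝ) (S : Set ℝ) : ℝ :=
  ∑ A ∈ Finset.univ.filter (fun A => IsGraph A), erWeight Q A * (𝒜 A S).toReal

section Prob

variable {n : ℕ}

/-- Independence of the edges: sums over graphs of edge products factorize. -/
theorem sum_isGraph_prod (F : Fin n → Fin n → Bool → ℝ) :
    ∑ A ∈ Finset.univ.filter (fun A : Fin n → Fin n → Bool => IsGraph A),
      ∏ i, ∏ j ∈ Finset.univ.filter (fun j => i < j), F i j (A i j) =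
    ∏ i, ∏ j ∈ Finset.univ.filter (fun j => i < j), (F i j true + F i j false) := by
  let P := {p : Fin n × Fin n // p.1 < p.2}
  have key : ∀ G : Fin n → Fin n → ℝ,
      ∏ i, ∏ j ∈ Finset.univ.filter (fun j => i < j), G i j = ∏ p : P, G p.1.1 p.1.2 := by
    intro G
    simp_rw [Finset.prod_filter]
    rw [← Fintype.prod_prod_type' (f := fun i j => if i < j then G i j else 1),
      ← Finset.prod_filter]
    exact (Finset.prod_subtype _ (by simp) (fun p : Fin n × Fin n => G p.1 p.2))
  simp_rw [key]
  have h2 : ∀ p : P, F p.1.1 p.1.2 true + F p.1.1 p.1.2 false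
      = ∑ b : Bool, F p.1.1 p.1.2 b := by simp
  simp_rw [h2]
  rw [Finset.prod_univ_sum, Fintype.piFinset_univ]
  refine Finset.sum_bij' (fun A _ p => A p.1.1 p.1.2)
    (fun x _ i j => if h : i < j then x ⟨(i, j), h⟩ else
      if h : j < i then x ⟨(j, i), h⟩ else false) ?_ ?_ ?_ ?_ ?_
  · simp
  · intro x _
    simp only [Finset.mem_filter, Finset.mem_univ, true_and]
    refine ⟨fun i j => ?_, fun i => by simp⟩
    rcases lt_trichotomy i j with h | h | h
    · simp [h, h.not_gt]
    · simp [h]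
    · simp [h, h.not_gt]
  · intro A hA
    obtain ⟨hs, hd⟩ := (Finset.mem_filter.1 hA).2
    funext i j
    rcases lt_trichotomy i j with h | h | h
    · simp [h]
    · simp [h, hd]
    · simp [h, h.not_gt, hs i j]
  · intro x _
    funext p
    simp [p.2]
  · intro A _
    rfl

variable {Q : Matrix (Fin n) (Fin n) ℝ}

theorem erWeight_nonneg (hQ : ∀ i j, 0 ≤ Q i j ∧ Q i j ≤ 1) (A : Fin n → Fin n → Bool) :
    0 ≤ erWeight Q A := by
  refine Finset.prod_nonneg fun i _ => Finset.prod_nonneg fun j _ => ?_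
  split_ifs
  · exact (hQ i j).1
  · linarith [(hQ i j).2]

theorem erProb_true : erProb Q (fun _ => True) = 1 := by
  have h := sum_isGraph_prod (fun i j b => if b then Q i j else 1 - Q i j)
  simpa [erProb, erWeight] using h

theorem erProb_eq_sum_ite (E : (Fin n → Fin n → Bool) → Prop) :
    erProb Q E = ∑ A ∈ Finset.univ.filter (fun A : Fin n → Fin n → Bool => IsGraph A),
      if E A then erWeight Q A else 0 := by
  rw [erProb, ← Finset.filter_filter, Finset.sum_filter]

theorem erProb_mono (hQ : ∀ i j, 0 ≤ Q i j ∧ Q i j ≤ 1)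
    {E F : (Fin n → Fin n → Bool) → Prop} (h : ∀ A, IsGraph A → E A → F A) :
    erProb Q E ≤ erProb Q F := by
  refine Finset.sum_le_sum_of_subset_of_nonneg (fun A hA => ?_)
    (fun A _ _ => erWeight_nonneg hQ A)
  simp only [Finset.mem_filter, Finset.mem_univ, true_and] at hA ⊢
  exact ⟨hA.1, h A hA.1 hA.2⟩

theorem erProb_or_le (hQ : ∀ i j, 0 ≤ Q i j ∧ Q i j ≤ 1)
    (E F : (Fin n → Fin n → Bool) → Prop) :
    erProb Q (fun A => E A ∨ F A) ≤ erProb Q E + erProb Q F := by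
  simp_rw [erProb_eq_sum_ite, ← Finset.sum_add_distrib]
  refine Finset.sum_le_sum fun A _ => ?_
  have := erWeight_nonneg hQ A
  by_cases h1 : E A <;> by_cases h2 : F A <;> simp [h1, h2, this]

theorem erProb_exists_le (hQ : ∀ i j, 0 ≤ Q i j ∧ Q i j ≤ 1) {ι : Type*} (s : Finset ι)
    (E : ι → (Fin n → Fin n → Bool) → Prop) :
    erProb Q (fun A => ∃ a ∈ s, E a A) ≤ ∑ a ∈ s, erProb Q (E a) := by
  simp_rw [erProb_eq_sum_ite]
  rw [Finset.sum_comm]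
  refine Finset.sum_le_sum fun A _ => ?_
  have hw := erWeight_nonneg hQ A
  have hnn : ∀ a ∈ s, 0 ≤ if E a A then erWeight Q A else 0 := fun a _ => by
    split_ifs <;> simp [hw]
  split_ifs with h
  · obtain ⟨a, ha, hE⟩ := h
    have := Finset.single_le_sum hnn ha
    simpa [hE] using this
  · exact Finset.sum_nonneg hnn

/-- A weighted sum of row sums, rewritten as a sum over edges. -/
theorem sum_mul_rowSum {M : Matrix (Fin n) (Fin n) ℝ} (hs : ∀ i j, M i j = M j i)
    (hd : ∀ i, M i i = 0) (u : Fin n → ℝ) :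
    ∑ i, u i * rowSum M i =
      ∑ i, ∑ j ∈ Finset.univ.filter (fun j => i < j), (u i + u j) * M i j := by
  have h1 : ∀ i j, u i * M i j =
      (if i < j then u i * M i j else 0) + (if j < i then u i * M i j else 0) := by
    intro i j
    rcases lt_trichotomy i j with h | h | h
    · simp [h, h.not_gt]
    · simp [h, hd]
    · simp [h, h.not_gt]
  simp_rw [rowSum, Finset.mul_sum]
  rw [Finset.sum_congr rfl fun i _ => Finset.sum_congr rfl fun j _ => h1 i j]
  simp_rw [Finset.sum_add_distrib]
  rw [Finset.sum_comm (f := fun i j => if j < i then u i * M i j else 0),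
    ← Finset.sum_add_distrib]
  refine Finset.sum_congr rfl fun i _ => ?_
  rw [← Finset.sum_add_distrib, Finset.sum_filter]
  refine Finset.sum_congr rfl fun j _ => ?_
  rw [hs j i]
  split_ifs <;> ring

theorem adjMat_symm {A : Fin n → Fin n → Bool} (hA : IsGraph A) (i j : Fin n) :
    adjMat A i j = adjMat A j i := by
  simp [adjMat, hA.1 i j]

theorem adjMat_diag {A : Fin n → Fin n → Bool} (hA : IsGraph A) (i : Fin n) :
    adjMat A i i = 0 := by
  simp [adjMat, hA.2 i]

/-- Bound on the moment generating function of a weighted sum of degrees. -/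
theorem sum_erWeight_mul_exp_le (hQ : ∀ i j, 0 ≤ Q i j ∧ Q i j ≤ 1) (u : Fin n → ℝ) :
    ∑ A ∈ Finset.univ.filter (fun A : Fin n → Fin n → Bool => IsGraph A),
      erWeight Q A * Real.exp (∑ i, u i * rowSum (adjMat A) i) ≤
    Real.exp (∑ i, ∑ j ∈ Finset.univ.filter (fun j => i < j),
      Q i j * (Real.exp (u i + u j) - 1)) := by
  let F : Fin n → Fin n → Bool → ℝ :=
    fun i j b => if b then Q i j * Real.exp (u i + u j) else 1 - Q i j
  have h : ∀ A ∈ Finset.univ.filter (fun A : Fin n → Fin n → Bool => IsGraph A),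
      erWeight Q A * Real.exp (∑ i, u i * rowSum (adjMat A) i) =
      ∏ i, ∏ j ∈ Finset.univ.filter (fun j => i < j), F i j (A i j) := by
    intro A hA
    have hA := (Finset.mem_filter.1 hA).2
    rw [sum_mul_rowSum (adjMat_symm hA) (adjMat_diag hA), Real.exp_sum]
    simp_rw [Real.exp_sum]
    rw [erWeight, ← Finset.prod_mul_distrib]
    refine Finset.prod_congr rfl fun i _ => ?_
    rw [← Finset.prod_mul_distrib]
    refine Finset.prod_congr rfl fun j _ => ?_
    by_cases hij : A i j <;> simp [adjMat, F, hij]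
  rw [(Finset.sum_congr rfl h).trans (sum_isGraph_prod F), Real.exp_sum]
  simp_rw [Real.exp_sum]
  have hb : ∀ i j, 0 ≤ F i j true + F i j false := fun i j => by
    have h1 := mul_nonneg (hQ i j).1 (Real.exp_pos (u i + u j)).le
    simp only [F, if_true, Bool.false_eq_true, if_false]
    linarith [(hQ i j).2]
  refine Finset.prod_le_prod (fun i _ => Finset.prod_nonneg fun j _ => hb i j)
    fun i _ => Finset.prod_le_prod (fun j _ => hb i j) fun j _ => ?_
  have := Real.add_one_le_exp (Q i j * (Real.exp (u i + u j) - 1))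
  simp only [F, if_true, Bool.false_eq_true, if_false]
  linarith

/-- Chernoff's bound for a weighted sum of degrees. -/
theorem erProb_le_exp (hQ : ∀ i j, 0 ≤ Q i j ∧ Q i j ≤ 1) (u : Fin n → ℝ) (a : ℝ) :
    erProb Q (fun A => a ≤ ∑ i, u i * rowSum (adjMat A) i) ≤
    Real.exp ((∑ i, ∑ j ∈ Finset.univ.filter (fun j => i < j),
      Q i j * (Real.exp (u i + u j) - 1)) - a) := by
  rw [Real.exp_sub, le_div_iff₀ (Real.exp_pos a)]
  refine le_trans ?_ (sum_erWeight_mul_exp_le hQ u)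
  rw [erProb_eq_sum_ite, Finset.sum_mul]
  refine Finset.sum_le_sum fun A _ => ?_
  have hw := erWeight_nonneg hQ A
  split_ifs with h
  · exact mul_le_mul_of_nonneg_left (Real.exp_le_exp.2 h) hw
  · rw [zero_mul]; positivity

theorem sum_rowSum (hn : 0 < n) (M : Matrix (Fin n) (Fin n) ℝ) :
    ∑ i, rowSum M i = n * dbar M := by
  have : (n : ℝ) ≠ 0 := by positivity
  rw [dbar, mul_div_cancel₀ _ this]
  rfl

/-- Chernoff's bound for the average degree, with `l` of either sign. -/
theorem erProb_dbar_le (hn : 0 < n) (hs : ∀ i j, Q i j = Q j i) (hd : ∀ i, Q i i = 0)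
    (hQ : ∀ i j, 0 ≤ Q i j ∧ Q i j ≤ 1) (l b : ℝ) (hl : |2 * l| ≤ 1) :
    erProb Q (fun A => l * b ≤ l * dbar (adjMat A)) ≤
      Real.exp (n * (dbar Q * (l + 2 * l ^ 2) - l * b)) := by
  have hn' : (0 : ℝ) < n := by positivity
  refine (erProb_mono hQ (F := fun A => n * (l * b) ≤ ∑ i, l * rowSum (adjMat A) i)
    fun A _ h => ?_).trans ((erProb_le_exp hQ (fun _ => l) _).trans (Real.exp_le_exp.2 ?_))
  · rw [← Finset.mul_sum, sum_rowSum hn]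
    have := mul_le_mul_of_nonneg_left h hn'.le
    linarith
  · have h1 := sum_mul_rowSum hs hd (fun _ => l)
    rw [← Finset.mul_sum, sum_rowSum hn] at h1
    have h2 : Real.exp (2 * l) - 1 ≤ 2 * l + (2 * l) ^ 2 := by
      have := (abs_le.1 (Real.abs_exp_sub_one_sub_id_le hl)).2
      linarith
    have h3 := sum_mul_rowSum hs hd (fun _ => (Real.exp (2 * l) - 1) / 2)
    rw [← Finset.mul_sum, sum_rowSum hn] at h3
    have h4 : ∑ i, ∑ j ∈ Finset.univ.filter (fun j => i < j), Q i j * (Real.exp (l + l) - 1) =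
        (Real.exp (2 * l) - 1) / 2 * (n * dbar Q) := by
      rw [h3]
      refine Finset.sum_congr rfl fun i _ => Finset.sum_congr rfl fun j _ => ?_
      rw [← two_mul]
      ring
    rw [h4]
    have hd0 : 0 ≤ n * dbar Q := by
      rw [← sum_rowSum hn]
      exact Finset.sum_nonneg fun i _ => Finset.sum_nonneg fun j _ => (hQ i j).1
    nlinarith [mul_le_mul_of_nonneg_right h2 hd0]

/-- Upper tail of the total degree of a fixed set of nodes. -/
theorem erProb_sum_rowSum_le (hs : ∀ i j, Q i j = Q j i) (hd : ∀ i, Q i i = 0)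
    (hQ : ∀ i j, 0 ≤ Q i j ∧ Q i j ≤ 1) {m : ℝ} (hm : ∀ i, rowSum Q i ≤ m)
    (S : Finset (Fin n)) (b : ℝ) :
    erProb Q (fun A => b ≤ ∑ i ∈ S, rowSum (adjMat A) i) ≤
      Real.exp (28 * (S.card * m) - 2 * b) := by
  have he4 : Real.exp 4 ≤ 56 := by
    have h1 := Real.exp_one_lt_d9
    have h2 : Real.exp 4 = Real.exp 1 ^ 4 := by rw [← Real.exp_nat_mul]; norm_num
    rw [h2]
    calc Real.exp 1 ^ 4 ≤ 2.72 ^ 4 := by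
          gcongr
          linarith
      _ ≤ 56 := by norm_num
  have he2 : Real.exp 2 ≤ 28 := by
    have h1 := Real.exp_one_lt_d9
    have h2 : Real.exp 2 = Real.exp 1 ^ 2 := by rw [← Real.exp_nat_mul]; norm_num
    rw [h2]
    nlinarith [Real.exp_pos 1]
  have hsum : ∀ (c : ℝ) (f : Fin n → ℝ),
      ∑ i, (if i ∈ S then c else 0) * f i = c * ∑ i ∈ S, f i := fun c f => by
    simp [Finset.mul_sum, Finset.sum_ite_mem]
  refine (erProb_mono hQ
    (F := fun A => 2 * b ≤ ∑ i, (if i ∈ S then (2 : ℝ) else 0) * rowSum (adjMat A) i)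
    fun A _ h => ?_).trans
      ((erProb_le_exp hQ (fun i => if i ∈ S then 2 else 0) _).trans (Real.exp_le_exp.2 ?_))
  · rw [hsum]
    linarith
  · have h1 := sum_mul_rowSum hs hd (fun i => if i ∈ S then 28 else 0)
    rw [hsum] at h1
    have h2 : ∑ i ∈ S, rowSum Q i ≤ S.card * m := by
      simpa using Finset.sum_le_card_nsmul S _ m fun i _ => hm i
    have h3 : ∑ i, ∑ j ∈ Finset.univ.filter (fun j => i < j),
        Q i j * (Real.exp ((if i ∈ S then 2 else 0) + (if j ∈ S then 2 else 0)) - 1) ≤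
        28 * ∑ i ∈ S, rowSum Q i := by
      rw [h1]
      refine Finset.sum_le_sum fun i _ => Finset.sum_le_sum fun j _ => ?_
      rw [mul_comm]
      refine mul_le_mul_of_nonneg_right ?_ (hQ i j).1
      split_ifs <;> norm_num <;> linarith
    linarith

end Prob

section Pruning

variable {n : ℕ}

theorem rowSum_adjMat_nonneg (A : Fin n → Fin n → Bool) (i : Fin n) :
    0 ≤ rowSum (adjMat A) i :=
  Finset.sum_nonneg fun j _ => by
    simp only [adjMat, Matrix.of_apply]
    split_ifs <;> norm_num

/-- If every set of `k + 1` nodes has total degree less than `(k + 1) * B`, then any `k` nodes,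
together with all nodes of degree larger than `B`, can be isolated without losing many edges. -/
theorem exists_pruned {A : Fin n → Fin n → Bool} (hA : IsGraph A) {k : ℕ} (hk : k + 1 ≤ n)
    {B : ℝ} (hB : 0 ≤ B)
    (hS : ∀ S : Finset (Fin n), S.card = k + 1 →
      ∑ i ∈ S, rowSum (adjMat A) i < (k + 1) * B)
    {T : Finset (Fin n)} (hT : T.card ≤ k) :
    ∃ (A' : Fin n → Fin n → Bool) (U : Finset (Fin n)), T ⊆ U ∧ U.card ≤ 2 * k ∧ IsGraph A' ∧
      (∀ i j, i ∉ U → j ∉ U → A' i j = A i j) ∧ (∀ i, rowSum (adjMat A') i ≤ B) ∧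
      dbar (adjMat A') ≤ dbar (adjMat A) ∧
      dbar (adjMat A) - 8 * k * B / n ≤ dbar (adjMat A') := by
  have hn : 0 < n := by omega
  have hn' : (0 : ℝ) < n := by positivity
  have hsmall : ∀ V : Finset (Fin n), V.card ≤ k →
      ∑ i ∈ V, rowSum (adjMat A) i ≤ 2 * k * B := by
    intro V hV
    rcases Nat.eq_zero_or_pos k with h0 | h0
    · subst h0
      have : V = ∅ := Finset.card_eq_zero.1 (by omega)
      simp [this]
    · obtain ⟨W, hVW, -, hW⟩ := Finset.exists_subsuperset_card_eq (Finset.subset_univ V)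
        (show V.card ≤ k + 1 by omega) (by simpa using hk)
      have h1 := Finset.sum_le_sum_of_subset_of_nonneg (f := fun i => rowSum (adjMat A) i) hVW
        (fun i _ _ => rowSum_adjMat_nonneg A i)
      have h2 := hS W hW
      have h3 : (1 : ℝ) ≤ k := by exact_mod_cast h0
      nlinarith
  let H : Finset (Fin n) := Finset.univ.filter fun i => B < rowSum (adjMat A) i
  have hH : H.card ≤ k := by
    by_contra! hc
    obtain ⟨W, hWH, hW⟩ := Finset.exists_subset_card_eq (show k + 1 ≤ H.card from hc)
    have h1 : (W.card : ℝ) * B ≤ ∑ i ∈ W, rowSum (adjMat A) i := by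
      simpa using Finset.card_nsmul_le_sum W (fun i => rowSum (adjMat A) i) B
        fun i hi => (Finset.mem_filter.1 (hWH hi)).2.le
    have h2 := hS W hW
    rw [hW] at h1
    push_cast at h1
    linarith
  let U := T ∪ H
  let A' : Fin n → Fin n → Bool := fun i j => A i j && (decide (i ∉ U) && decide (j ∉ U))
  have hle : ∀ i j, adjMat A' i j ≤ adjMat A i j := by
    intro i j
    simp only [adjMat, Matrix.of_apply, A']
    by_cases h : A i j <;> by_cases hi : i ∈ U <;> by_cases hj : j ∈ U <;> simp [h, hi, hj]
  refine ⟨A', U, Finset.subset_union_left, ?_, ⟨fun i j => ?_, fun i => ?_⟩, ?_, ?_, ?_, ?_⟩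
  · exact (Finset.card_union_le _ _).trans (by omega)
  · simp only [A', hA.1 i j, Bool.and_comm (decide (i ∉ U))]
  · simp [A', hA.2 i]
  · intro i j hi hj
    simp [A', hi, hj]
  · intro i
    by_cases hi : i ∈ U
    · have : rowSum (adjMat A') i = 0 := by simp [rowSum, adjMat, A', hi]
      rw [this]
      exact hB
    · have h1 : rowSum (adjMat A) i ≤ B := by
        by_contra! hc
        exact hi (Finset.mem_union_right _ (by simp [H, hc]))
      exact (Finset.sum_le_sum fun j _ => hle i j).trans h1
  · unfold dbar
    gcongr with i _ j _
    exact hle i j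
  · have h1 : ∀ i j, adjMat A i j ≤ adjMat A' i j +
        ((if i ∈ U then adjMat A i j else 0) + (if j ∈ U then adjMat A j i else 0)) := by
      intro i j
      rw [adjMat_symm hA j i]
      simp only [adjMat, Matrix.of_apply, A']
      by_cases h : A i j <;> by_cases hi : i ∈ U <;> by_cases hj : j ∈ U <;> simp [h, hi, hj]
    have h2 : ∑ i, rowSum (adjMat A) i ≤ ∑ i, rowSum (adjMat A') i +
        (∑ i ∈ U, rowSum (adjMat A) i + ∑ i ∈ U, rowSum (adjMat A) i) := by
      have h3 : ∑ i, ∑ j, (if i ∈ U then adjMat A i j else 0) =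
          ∑ i ∈ U, rowSum (adjMat A) i := by
        rw [← Finset.sum_filter_add_sum_filter_not Finset.univ (fun i => i ∈ U),
          Finset.sum_eq_zero (s := Finset.univ.filter (fun i => i ∉ U))
            fun i hi => by simp [(Finset.mem_filter.1 hi).2]]
        simp [rowSum]
      have h4 : ∑ i, ∑ j, (if j ∈ U then adjMat A j i else 0) =
          ∑ i ∈ U, rowSum (adjMat A) i := by
        rw [Finset.sum_comm]
        exact h3
      calc _ ≤ ∑ i, ∑ j, (adjMat A' i j +
            ((if i ∈ U then adjMat A i j else 0) + (if j ∈ U then adjMat A j i else 0))) :=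
            Finset.sum_le_sum fun i _ => Finset.sum_le_sum fun j _ => h1 i j
        _ = _ := by
            simp_rw [Finset.sum_add_distrib]
            rw [h3, h4]
            rfl
    have h5 : ∑ i ∈ U, rowSum (adjMat A) i ≤ 4 * k * B := by
      have h6 := Finset.sum_union_inter (s₁ := T) (s₂ := H) (f := fun i => rowSum (adjMat A) i)
      have h7 : 0 ≤ ∑ i ∈ T ∩ H, rowSum (adjMat A) i :=
        Finset.sum_nonneg fun i _ => rowSum_adjMat_nonneg A i
      have h8 := hsmall T hT
      have h9 := hsmall H hH
      simp only [U]
      linarith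
    rw [sum_rowSum hn, sum_rowSum hn] at h2
    rw [sub_le_iff_le_add, ← mul_le_mul_iff_right₀ hn', mul_add, mul_div_cancel₀ _ hn'.ne']
    linarith

end Pruning

theorem exists_card_eq_nodeDist {n : ℕ} (A B : Fin n → Fin n → Bool) :
    ∃ S : Finset (Fin n), S.card = nodeDist A B ∧
      ∀ i j, i ∉ S → j ∉ S → A i j = B i j :=
  Nat.sInf_mem (s := {k | ∃ S : Finset (Fin n), S.card = k ∧
    ∀ i j, i ∉ S → j ∉ S → A i j = B i j}) ⟨_, Finset.univ, rfl, by simp⟩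

theorem choose_le_exp {n k : ℕ} {η : ℝ} (hη : 0 < η) (hk : η * n ≤ k) :
    (n.choose k : ℝ) ≤ Real.exp (k * (1 + Real.log (1 / η))) := by
  have h1 : (n.choose k : ℝ) ≤ (n : ℝ) ^ k / (k.factorial : ℝ) := Nat.choose_le_pow_div k n
  have h2 : (k : ℝ) ^ k / (k.factorial : ℝ) ≤ Real.exp k :=
    Real.pow_div_factorial_le_exp _ (by positivity) k
  have h3 : (n : ℝ) ≤ 1 / η * k := by
    rw [one_div, ← div_eq_inv_mul, le_div_iff₀ hη]
    linarith
  calc (n.choose k : ℝ) ≤ (1 / η * k) ^ k / (k.factorial : ℝ) := by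
        refine h1.trans ?_
        gcongr
    _ = (1 / η) ^ k * ((k : ℝ) ^ k / (k.factorial : ℝ)) := by rw [mul_pow]; ring
    _ ≤ (1 / η) ^ k * Real.exp k := by gcongr
    _ = Real.exp (k * (1 + Real.log (1 / η))) := by
        rw [mul_add, Real.exp_add, mul_one, Real.exp_nat_mul (Real.log (1 / η)),
          Real.exp_log (by positivity), mul_comm]

theorem half_log_le {n k : ℕ} {η : ℝ} (hn : 0 < n) (hη : 0 < η)
    (hL : 1 ≤ Real.log (1 / η)) (hk : η * n ≤ k) (hk1 : 1 ≤ k) :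
    Real.log n / 2 ≤ k * Real.log (1 / η) := by
  have hn' : (0 : ℝ) < n := by positivity
  have hk1' : (1 : ℝ) ≤ k := by exact_mod_cast hk1
  have hlog : Real.log (Real.sqrt n) = Real.log n / 2 := Real.log_sqrt hn'.le
  have hsq : 0 < Real.sqrt n := Real.sqrt_pos.2 hn'
  rcases le_total (Real.sqrt n) (1 / η) with h | h
  · have := Real.log_le_log hsq h
    nlinarith
  · have h1 : 1 ≤ η * Real.sqrt n := by
      rw [div_le_iff₀ hη] at h
      linarith
    have h2 : Real.sqrt n ≤ k := by
      have h3 : Real.sqrt n * Real.sqrt n = n := Real.mul_self_sqrt hn'.le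
      nlinarith
    have h4 := Real.log_le_self hsq.le
    nlinarith

/-- Union bound over all sets of `k` nodes. -/
theorem erProb_exists_card_le {n k : ℕ} {Q : Matrix (Fin n) (Fin n) ℝ} {η m : ℝ} (hn : 0 < n)
    (hs : ∀ i j, Q i j = Q j i) (hd : ∀ i, Q i i = 0)
    (hQ : ∀ i j, 0 ≤ Q i j ∧ Q i j ≤ 1) (hm : ∀ i, rowSum Q i ≤ m) (hm5 : 5 ≤ m)
    (hη : 0 < η) (hL : 30 ≤ Real.log (1 / η)) (hk : η * n ≤ k) (hk1 : 1 ≤ k) :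
    erProb Q (fun A => ∃ S ∈ Finset.powersetCard k (Finset.univ : Finset (Fin n)),
      k * (1.8 * Real.log (1 / η) * m) ≤ ∑ i ∈ S, rowSum (adjMat A) i) ≤ 1 / n := by
  have hn' : (0 : ℝ) < n := by positivity
  set L := Real.log (1 / η) with hLdef
  refine (erProb_exists_le hQ _ _).trans ?_
  have h1 : ∀ S ∈ Finset.powersetCard k (Finset.univ : Finset (Fin n)),
      erProb Q (fun A => k * (1.8 * L * m) ≤ ∑ i ∈ S, rowSum (adjMat A) i) ≤
        Real.exp (28 * (k * m) - 2 * (k * (1.8 * L * m))) := by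
    intro S hS
    have := erProb_sum_rowSum_le hs hd hQ hm S (k * (1.8 * L * m))
    rwa [(Finset.mem_powersetCard.1 hS).2] at this
  refine (Finset.sum_le_card_nsmul _ _ _ h1).trans ?_
  rw [Finset.card_powersetCard, Finset.card_univ, Fintype.card_fin, nsmul_eq_mul]
  have hhalf := half_log_le hn hη (by linarith) hk hk1
  have hk0 : (0 : ℝ) ≤ k := by positivity
  calc _ ≤ Real.exp (k * (1 + L)) * Real.exp (28 * (k * m) - 2 * (k * (1.8 * L * m))) := by
        gcongr
        exact choose_le_exp hη hk
    _ ≤ Real.exp (-Real.log n) := by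
        rw [← Real.exp_add, Real.exp_le_exp]
        have e1 : 13 * L ≤ m * (3.6 * L - 28) := by nlinarith
        have e2 := mul_le_mul_of_nonneg_left e1 hk0
        have e3 : (k : ℝ) ≤ k * L := by nlinarith
        have e4 : 0 ≤ (k : ℝ) * L := by linarith
        linarith
    _ = 1 / n := by rw [Real.exp_neg, Real.exp_log hn', one_div]

/-- feasibility for coarse estimation: with high probability
over `A° ~ G(n,Q°)`, for every `η`-corruption `A` of `A°` there is a feasible
solution with average degree close to `d°`. -/
theorem coarse_feasibility :
    ∃ c > (0 : ℝ), ∃ c' > (0 : ℝ), ∃ C > (0 : ℝ), ∃ N : ℕ, ∀ n ≥ N,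
      ∀ (Q : Matrix (Fin n) (Fin n) ℝ) (R η : ℝ),
        (∀ i j, Q i j = Q j i) → (∀ i, Q i i = 0) →
        (∀ i j, 0 ≤ Q i j ∧ Q i j ≤ 1) →
        C ≤ dbar Q → 1 ≤ R → (∀ i j, Q i j ≤ R * dbar Q / n) →
        5 ≤ R * dbar Q →
        0 < η → η < 1 / Real.exp 1 → η * Real.log (1 / η) * R ≤ c →
        1 - (n : ℝ) ^ (-c' : ℝ) ≤
          erProb Q (fun A₀ =>
            ∀ A : Fin n → Fin n → Bool, IsGraph A →
              (nodeDist A A₀ : ℝ) ≤ η * n →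
              ∃ (Astar : Fin n → Fin n → Bool) (zstar : Fin n → ℝ),
                IsGraph Astar ∧
                |dbar (adjMat Astar) - dbar Q| ≤ 0.1 * dbar Q ∧
                P1 (adjMat A) (2 * η) (adjMat Astar) zstar ∧
                ∀ i, rowSum (adjMat Astar) i ≤
                  2 * Real.log (1 / η) * R * dbar (adjMat Astar)) := by
  refine ⟨Real.exp (-30), Real.exp_pos _, 1 / 2, by norm_num, 3200, by norm_num, 9, ?_⟩
  intro n hn Q R η hs hd hQ hC hR hQR h5 hη hηe hc
  have hn0 : 0 < n := by omega
  have hn' : (0 : ℝ) < n := by positivity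
  have hn9 : (9 : ℝ) ≤ n := by exact_mod_cast hn
  set D := dbar Q with hD
  set L := Real.log (1 / η) with hLdef
  have hexp30 : Real.exp (-30) ≤ 1 / 1000 := by
    have h1 := Real.add_one_le_exp (-(10 : ℝ))
    have h2 : Real.exp (-30) = (Real.exp 10)⁻¹ ^ 3 := by
      rw [← Real.exp_neg, ← Real.exp_nat_mul]; norm_num
    have h3 := Real.add_one_le_exp (10 : ℝ)
    have h4 : (Real.exp 10)⁻¹ ≤ 10⁻¹ := by
      apply inv_anti₀ <;> linarith
    rw [h2]
    calc (Real.exp 10)⁻¹ ^ 3 ≤ (10⁻¹ : ℝ) ^ 3 := by gcongr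
      _ = 1 / 1000 := by norm_num
  have hL1 : 1 ≤ L := by
    rw [hLdef, Real.le_log_iff_exp_le (by positivity), le_div_iff₀ hη]
    rw [lt_div_iff₀ (Real.exp_pos 1)] at hηe
    linarith
  have hηc : η ≤ Real.exp (-30) := by
    have h1 : η ≤ η * L := by nlinarith
    have h2 : η * L ≤ η * L * R := by nlinarith [mul_pos hη (by linarith : 0 < L)]
    linarith
  have hL30 : 30 ≤ L := by
    have := Real.log_le_log hη hηc
    rw [Real.log_exp] at this
    rw [hLdef, one_div, Real.log_inv]
    linarith
  have hη1 : η < 1 := by linarith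
  set k := ⌊η * n⌋₊ with hkdef
  have hkle : (k : ℝ) ≤ η * n := Nat.floor_le (by positivity)
  have hklt : η * n < k + 1 := Nat.lt_floor_add_one _
  have hkn : k + 1 ≤ n := by
    have : (k : ℝ) < n := by nlinarith
    exact_mod_cast this
  have hrow : ∀ i, rowSum Q i ≤ R * D := fun i => by
    calc rowSum Q i ≤ ∑ _j : Fin n, R * D / n := Finset.sum_le_sum fun j _ => hQR i j
      _ = R * D := by simp; field_simp
  have hexpn : Real.exp (-n) ≤ 1 / n := by
    rw [Real.exp_neg, one_div]
    apply inv_anti₀ hn'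
    linarith [Real.add_one_le_exp (n : ℝ)]
  have hbad1 := erProb_exists_card_le (k := k + 1) hn0 hs hd hQ hrow h5 hη hL30
    (by push_cast; exact hklt.le) (by omega)
  have hbad2 := (erProb_dbar_le hn0 hs hd hQ (1 / 80) (1.05 * D)
    (by rw [abs_le]; norm_num)).trans (b := _) (c := 1 / (n : ℝ))
      (le_trans (Real.exp_le_exp.2 (by rw [← hD]; nlinarith)) hexpn)
  have hbad3 := (erProb_dbar_le hn0 hs hd hQ (-(1 / 80)) (0.95 * D)
    (by rw [abs_le]; norm_num)).trans (b := _) (c := 1 / (n : ℝ))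
      (le_trans (Real.exp_le_exp.2 (by rw [← hD]; nlinarith)) hexpn)
  have hfail : 3 / (n : ℝ) ≤ (n : ℝ) ^ (-(1 / 2) : ℝ) := by
    rw [Real.rpow_neg hn'.le, ← Real.sqrt_eq_rpow, div_le_iff₀ hn', ← div_eq_inv_mul,
      Real.div_sqrt]
    exact Real.le_sqrt_of_sq_le (by linarith)
  rw [← hLdef] at hbad1
  set bad1 : (Fin n → Fin n → Bool) → Prop := fun A =>
    ∃ S ∈ Finset.powersetCard (k + 1) (Finset.univ : Finset (Fin n)),
      ((k + 1 : ℕ) : ℝ) * (1.8 * L * (R * D)) ≤ ∑ i ∈ S, rowSum (adjMat A) i with hb1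
  set bad2 : (Fin n → Fin n → Bool) → Prop := fun A =>
    1 / 80 * (1.05 * D) ≤ 1 / 80 * dbar (adjMat A) with hb2
  set bad3 : (Fin n → Fin n → Bool) → Prop := fun A =>
    -(1 / 80) * (0.95 * D) ≤ -(1 / 80) * dbar (adjMat A) with hb3
  set good : (Fin n → Fin n → Bool) → Prop := fun A₀ =>
    ∀ A : Fin n → Fin n → Bool, IsGraph A →
      (nodeDist A A₀ : ℝ) ≤ η * n →
      ∃ (Astar : Fin n → Fin n → Bool) (zstar : Fin n → ℝ),
        IsGraph Astar ∧
        |dbar (adjMat Astar) - D| ≤ 0.1 * D ∧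
        P1 (adjMat A) (2 * η) (adjMat Astar) zstar ∧
        ∀ i, rowSum (adjMat Astar) i ≤
          2 * L * R * dbar (adjMat Astar) with hgood
  have hcover : ∀ A, IsGraph A → True → good A ∨ bad1 A ∨ bad2 A ∨ bad3 A := by
    intro A₀ hA₀ _
    by_contra! hnot
    obtain ⟨hng, h1, h2, h3⟩ := hnot
    refine hng fun A hA hdist => ?_
    simp only [hb1, not_exists, not_and, not_le, Finset.mem_powersetCard_univ] at h1
    simp only [hb2, not_le] at h2
    simp only [hb3, not_le] at h3
    obtain ⟨T, hT, hagree⟩ := exists_card_eq_nodeDist A A₀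
    have hTk : T.card ≤ k := by
      rw [hT]
      exact Nat.le_floor hdist
    have hB : 0 ≤ 1.8 * L * (R * D) := by positivity
    obtain ⟨A', U, hTU, hU, hA', hAU, hdeg, hup, hlow⟩ :=
      exists_pruned hA₀ hkn hB (fun S hS => by simpa using h1 S hS) hTk
    have hloss : 8 * k * (1.8 * L * (R * D)) / n ≤ 0.04 * D := by
      rw [div_le_iff₀ hn']
      have e1 : 8 * k * (1.8 * L * (R * D)) ≤ 8 * (η * n) * (1.8 * L * (R * D)) := by
        gcongr
      have e2 : η * L * R * (D * n) ≤ 1 / 1000 * (D * n) := by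
        have : 0 ≤ D * n := by positivity
        exact mul_le_mul_of_nonneg_right (hc.trans hexp30) this
      nlinarith
    have hlow' : 0.9 * D ≤ dbar (adjMat A') := by linarith
    refine ⟨A', fun i => if i ∈ U then 0 else 1, hA', ?_, ⟨fun i => ?_, ?_, adjMat_symm hA',
      fun i j => ?_, fun i j => ?_⟩, fun i => ?_⟩
    · rw [abs_le]
      constructor <;> linarith
    · by_cases hi : i ∈ U <;> simp [hi]
    · have e1 : ∑ i : Fin n, (if i ∈ U then (0 : ℝ) else 1) = n - U.card := by
        have : ∀ i : Fin n, (if i ∈ U then (0 : ℝ) else 1) = 1 - if i ∈ U then 1 else 0 := by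
          intro i
          split_ifs <;> simp
        simp_rw [this, Finset.sum_sub_distrib]
        simp
      have e2 : (U.card : ℝ) ≤ 2 * k := by exact_mod_cast hU
      rw [e1]
      linarith
    · simp only [adjMat, Matrix.of_apply]
      split_ifs <;> norm_num
    · by_cases hi : i ∈ U
      · simp [hi]
      by_cases hj : j ∈ U
      · simp [hj]
      simp [adjMat, hAU i j hi hj, hagree i j (fun h => hi (hTU h)) (fun h => hj (hTU h))]
    · have e1 : 0 ≤ 2 * L * R := by positivity
      have e2 := mul_le_mul_of_nonneg_left hlow' e1
      linarith [hdeg i]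
  have htot := erProb_mono hQ hcover
  rw [erProb_true] at htot
  have u1 := erProb_or_le hQ good (fun A => bad1 A ∨ bad2 A ∨ bad3 A)
  have u2 := erProb_or_le hQ bad1 (fun A => bad2 A ∨ bad3 A)
  have u3 := erProb_or_le hQ bad2 bad3
  have h3n : 3 / (n : ℝ) = 1 / n + 1 / n + 1 / n := by ring
  linarith

end EdgeDensity
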